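/- arXiv:2502.17148 — 4 statements merged into one kernel-verified Lean document; each statement's English description precedes it below -/
import Mathlib

section
/- Let R be a Noetherian local ring and f ∈ R a nonzerodivisor contained in the maximal ideal. If the quotient ring R/(f) is reduced, then R is reduced. -/
/-- If `R ⧸ (f)` is reduced for a nonzerodivisor `f`, then every nilpotent element of `R` is
divisible by all powers of `f`. -/
theorem IsNilpotent.pow_dvd_of_isReduced_quotient {R : Type*} [CommRing R] {f : R}
    (hf : f ∈ nonZeroDivisors R) [IsReduced (R ⧸ Ideal.span ({f} : Set R))] (n : ℕ) {r : R}
    (hr : IsNilpotent r) : f ^ n ∣ r := by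
  induction n generalizing r with
  | zero => simp
  | succ n ih =>
    obtain ⟨s, rfl⟩ : f ∣ r := by
      rw [← Ideal.mem_span_singleton, ← Ideal.Quotient.eq_zero_iff_mem]
      exact (hr.map (Ideal.Quotient.mk (Ideal.span {f}))).eq_zero
    have hs : IsNilpotent s := by
      obtain ⟨k, hk⟩ := hr
      rw [mul_pow] at hk
      exact ⟨k, (mul_left_mem_nonZeroDivisors_eq_zero_iff (pow_mem hf k)).mp hk⟩
    rw [pow_succ']
    exact mul_dvd_mul_left f (ih hs)

/-- Let `R` be a Noetherian local ring and `f ∈ R` a nonzerodivisor contained in the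
maximal ideal. If the quotient ring `R/(f)` is reduced, then `R` is reduced. -/
theorem stmt_1 (R : Type*) [CommRing R] [IsNoetherianRing R] [IsLocalRing R]
    (f : R) (hf : f ∈ IsLocalRing.maximalIdeal R) (hnzd : f ∈ nonZeroDivisors R)
    (hred : IsReduced (R ⧸ Ideal.span ({f} : Set R))) :
    IsReduced R := by
  refine ⟨fun r hr => ?_⟩
  have hne : Ideal.span {f} ≠ ⊤ := by
    rwa [Ne, Ideal.span_singleton_eq_top, ← mem_nonunits_iff, ← IsLocalRing.mem_maximalIdeal]
  rw [← Ideal.mem_bot, ← Ideal.iInf_pow_eq_bot_of_isLocalRing _ hne, Ideal.mem_iInf]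
  intro n
  rw [Ideal.span_singleton_pow, Ideal.mem_span_singleton]
  exact hr.pow_dvd_of_isReduced_quotient hnzd n
end

section
/- Let p be a prime and (R, 𝔪) an F-finite Noetherian local domain of characteristic p which is not a field. Assume: (i) R is strongly F-regular, i.e. for every nonzero c ∈ R there exist an integer e ≥ 1 and an R-linear map φ : F^e_*R → R with φ(F^e_*c) = 1; and (ii) Hom_R(F_*R, R) is free of rank one as an F_*R-module, i.e. there exists an R-linear map ψ₀ : F_*R → R such that s ↦ ψ₀(s·−) is a bijection from R onto Hom_R(F_*R, R) (this holds when R is Gorenstein). Then there exist an element x ∈ 𝔪 and an R-linear map φ : F_*R → R with φ(F_*x) = 1. -/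
/-- If `ψ` generates `Hom_R(F_*R, R)`, then every `R`-linear map `φ : F^(e+1)_*R → R` factors as
`ψ ∘ θ` for an `R`-linear map `θ : F^e_*R → R`. -/
theorem exists_eq_generator_comp (p : ℕ) [Fact p.Prime] (R : Type*) [CommRing R] [CharP R p]
    (ψ : R →+ R)
    (hgen : ∀ φ : R →+ R, (∀ r y : R, φ (r ^ p * y) = r * φ y) →
      ∃! s : R, ∀ y : R, φ y = ψ (s * y))
    (e : ℕ) (φ : R →+ R) (hφ : ∀ r y : R, φ (r ^ p ^ (e + 1) * y) = r * φ y) :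
    ∃ θ : R →+ R, (∀ r y : R, θ (r ^ p ^ e * y) = r * θ y) ∧ ∀ y : R, φ y = ψ (θ y) := by
  have key (y : R) : ∃! s : R, ∀ z : R, φ (z ^ p ^ e * y) = ψ (s * z) := by
    refine hgen ((φ.comp (AddMonoidHom.mulRight y)).comp
      (iterateFrobenius R p e : R →+ R)) fun r z => ?_
    have h := hφ r (z ^ p ^ e * y)
    simpa [iterateFrobenius_def, mul_pow, ← pow_mul, pow_succ', mul_assoc] using h
  choose θ hθ huniq using key
  refine ⟨AddMonoidHom.mk' θ fun a b => ?_, fun r y => ?_, fun y => ?_⟩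
  · refine (huniq _ _ fun z => ?_).symm
    rw [mul_add, map_add, hθ, hθ, add_mul, map_add]
  · refine (huniq _ _ fun z => ?_).symm
    rw [← mul_assoc, ← mul_pow, hθ]
    congr 1
    simp only [AddMonoidHom.mk'_apply]
    ring
  · simpa using hθ y 1

/-- If `ψ` generates `Hom_R(F_*R, R)` and maps an ideal into itself, then so does every `R`-linear
map `F^e_*R → R`. -/
theorem map_mem_of_generator_map_mem (p : ℕ) [Fact p.Prime] (R : Type*) [CommRing R] [CharP R p]
    (ψ : R →+ R)
    (hgen : ∀ φ : R →+ R, (∀ r y : R, φ (r ^ p * y) = r * φ y) →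
      ∃! s : R, ∀ y : R, φ y = ψ (s * y))
    (I : Ideal R) (hI : ∀ x ∈ I, ψ x ∈ I)
    (e : ℕ) (φ : R →+ R) (hφ : ∀ r y : R, φ (r ^ p ^ e * y) = r * φ y) :
    ∀ x ∈ I, φ x ∈ I := by
  induction e generalizing φ with
  | zero =>
    intro x hx
    have h := hφ x 1
    rw [pow_zero, pow_one, mul_one] at h
    exact h ▸ I.mul_mem_right _ hx
  | succ e ih =>
    intro x hx
    obtain ⟨θ, hθ, hφθ⟩ := exists_eq_generator_comp p R ψ hgen e φ hφ
    exact hφθ x ▸ hI _ (ih θ hθ x hx)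

/-- Let `p` be a prime and `(R, 𝔪)` an `F`-finite Noetherian local domain of
characteristic `p` which is not a field.  Assume that `R` is strongly `F`-regular and
that `Hom_R(F_*R, R)` is free of rank one as an `F_*R`-module (via a generator `ψ₀`).
Then there exist `x ∈ 𝔪` and an `R`-linear map `φ : F_*R → R` with `φ(F_*x) = 1`.

Here an `R`-linear map `F^e_*R → R` is encoded as an additive map `φ : R →+ R`
satisfying `φ (r ^ (p ^ e) * y) = r * φ y` for all `r, y : R`. -/
theorem stmt_5 (p : ℕ) (hp : p.Prime) (R : Type*) [CommRing R] [IsDomain R]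
    [IsNoetherianRing R] [IsLocalRing R] [CharP R p]
    (hnotfield : ¬ IsField R)
    -- `R` is `F`-finite: `F_*R` is a finite `R`-module
    (hFfin : ∃ (n : ℕ) (s : Fin n → R), ∀ x : R, ∃ c : Fin n → R,
      x = ∑ i, c i ^ p * s i)
    -- `R` is strongly `F`-regular
    (hSFR : ∀ c : R, c ≠ 0 → ∃ e : ℕ, 1 ≤ e ∧ ∃ φ : R →+ R,
      (∀ r y : R, φ (r ^ p ^ e * y) = r * φ y) ∧ φ c = 1)
    -- `Hom_R(F_*R, R)` is free of rank one as an `F_*R`-module, generated by `ψ₀`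
    (hGor : ∃ ψ₀ : R →+ R, (∀ r y : R, ψ₀ (r ^ p * y) = r * ψ₀ y) ∧
      ∀ φ : R →+ R, (∀ r y : R, φ (r ^ p * y) = r * φ y) →
        ∃! s : R, ∀ y : R, φ y = ψ₀ (s * y)) :
    ∃ x ∈ IsLocalRing.maximalIdeal R, ∃ φ : R →+ R,
      (∀ r y : R, φ (r ^ p * y) = r * φ y) ∧ φ x = 1 := by
  obtain ⟨ψ, hψ, hgen⟩ := hGor
  have : Fact p.Prime := ⟨hp⟩
  by_cases hx : ∀ x ∈ IsLocalRing.maximalIdeal R, ψ x ∈ IsLocalRing.maximalIdeal R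
  · exfalso
    obtain ⟨c, hc, hc0⟩ := Submodule.exists_mem_ne_zero_of_ne_bot
      (mt IsLocalRing.isField_iff_maximalIdeal_eq.mpr hnotfield)
    obtain ⟨e, -, φ, hφ, hφc⟩ := hSFR c hc0
    have hmem := map_mem_of_generator_map_mem p R ψ hgen _ hx e φ hφ c hc
    rw [hφc] at hmem
    exact (Ideal.ne_top_iff_one _).mp (IsLocalRing.maximalIdeal.isMaximal R).ne_top hmem
  · push Not at hx
    obtain ⟨x, hx, hψx⟩ := hx
    obtain ⟨u, hu⟩ := IsLocalRing.notMem_maximalIdeal.mp hψx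
    refine ⟨(↑u⁻¹ : R) ^ p * x, Ideal.mul_mem_left _ _ hx, ψ, hψ, ?_⟩
    rw [hψ, ← hu, Units.inv_mul]
end

section
/- Let k ⊆ L be an extension of fields and G a finite group acting on L by ring automorphisms that fix every element of k, and let K = L^G be the fixed subfield. Every σ ∈ G induces, by functoriality of Kähler differentials, an additive automorphism σ_* of Ω^1_{L/k} satisfying σ_*(a·ω) = σ(a)·σ_*(ω) and σ_*(da) = d(σ(a)) for all a ∈ L and ω ∈ Ω^1_{L/k}. Then the set of elements of Ω^1_{L/k} fixed by σ_* for every σ ∈ G equals the image of the canonical map Ω^1_{K/k} → Ω^1_{L/k}. -/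
/-- If `L / K` is separable algebraic, then `Ω[L⁄k]` is generated over `L` by the image
of `Ω[K⁄k]`. -/
theorem mapBaseChange_surjective_of_isSeparable (k K L : Type*) [Field k] [Field K] [Field L]
    [Algebra k K] [Algebra K L] [Algebra k L] [IsScalarTower k K L] [Algebra.IsSeparable K L] :
    Function.Surjective (KaehlerDifferential.mapBaseChange k K L) := by
  have : Algebra.FormallyUnramified K L := .of_isSeparable K L
  exact fun ω ↦ (KaehlerDifferential.exact_mapBaseChange_map k K L ω).mp (Subsingleton.elim _ _)

/-- If `G` acts on `L` with field of invariants `K`, then the image of `G` in `Gal(L/K)` is a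
Galois group of `L / K`. -/
theorem isGaloisGroup_range_toAlgAut (K L G : Type*) [Field K] [Field L] [Algebra K L]
    [Group G] [MulSemiringAction G L] [SMulCommClass G K L] [Algebra.IsInvariant K L G] :
    IsGaloisGroup (MulSemiringAction.toAlgAut G K L).range K L where
  faithful := inferInstance
  commutes := inferInstance
  isInvariant := ⟨fun b hb ↦ Algebra.IsInvariant.isInvariant (G := G) b
    fun g ↦ hb ⟨MulSemiringAction.toAlgAut G K L g, g, rfl⟩⟩

/-- A semilinear additive endomorphism of `Ω[L⁄k]` compatible with `D` and with an automorphism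
fixing `K` fixes the image of `Ω[K⁄k]`. -/
theorem semilinear_apply_kaehlerDifferential_map {k K L : Type*} [Field k] [Field K] [Field L]
    [Algebra k K] [Algebra K L] [Algebra k L] [IsScalarTower k K L] (s : L → L)
    (hs : ∀ x : K, s (algebraMap K L x) = algebraMap K L x)
    (φ : KaehlerDifferential k L →+ KaehlerDifferential k L)
    (hsmul : ∀ (a : L) (ω : KaehlerDifferential k L), φ (a • ω) = s a • φ ω)
    (hD : ∀ a : L, φ (KaehlerDifferential.D k L a) = KaehlerDifferential.D k L (s a))
    (η : KaehlerDifferential k K) :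
    φ (KaehlerDifferential.map k k K L η) = KaehlerDifferential.map k k K L η := by
  have hη : η ∈ Submodule.span K (Set.range (KaehlerDifferential.D k K)) := by
    rw [KaehlerDifferential.span_range_derivation]
    trivial
  induction hη using Submodule.span_induction with
  | mem x hx =>
    obtain ⟨b, rfl⟩ := hx
    rw [KaehlerDifferential.map_D, hD, hs]
  | zero => simp
  | add x y _ _ hx hy => rw [map_add, map_add, hx, hy]
  | smul a x _ hx => rw [map_smul, algebra_compatible_smul L a, hsmul, hs, hx]


/-- Let `k ⊆ L` be an extension of fields and `G` a finite group acting on `L` by ring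
automorphisms fixing `k` pointwise, with fixed subfield `K = L^G`.  Every `σ ∈ G`
induces an additive automorphism `σ_*` of `Ω¹_{L/k}` satisfying
`σ_*(a·ω) = σ(a)·σ_*(ω)` and `σ_*(da) = d(σ(a))`.  Then the set of elements of
`Ω¹_{L/k}` fixed by every `σ_*` equals the image of the canonical map
`Ω¹_{K/k} → Ω¹_{L/k}`. -/
theorem stmt_7 (k K L : Type*) [Field k] [Field K] [Field L]
    [Algebra k K] [Algebra K L] [Algebra k L] [IsScalarTower k K L]
    (G : Type*) [Group G] [Finite G] [MulSemiringAction G L]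
    (hfix_k : ∀ (σ : G) (a : k), σ • (algebraMap k L a) = algebraMap k L a)
    (hK : ∀ x : L, (∀ σ : G, σ • x = x) ↔ x ∈ (algebraMap K L).range)
    (Φ : G → (KaehlerDifferential k L →+ KaehlerDifferential k L))
    (hΦsmul : ∀ (σ : G) (a : L) (ω : KaehlerDifferential k L),
      Φ σ (a • ω) = (σ • a) • Φ σ ω)
    (hΦd : ∀ (σ : G) (a : L),
      Φ σ (KaehlerDifferential.D k L a) = KaehlerDifferential.D k L (σ • a)) :
    {ω : KaehlerDifferential k L | ∀ σ : G, Φ σ ω = ω} =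
      Set.range (KaehlerDifferential.map k k K L) := by
  have : SMulCommClass G K L := ⟨fun σ a x ↦ by
    rw [Algebra.smul_def, Algebra.smul_def, smul_mul', (hK _).mpr ⟨a, rfl⟩ σ]⟩
  have : Algebra.IsInvariant K L G := ⟨fun b hb ↦ (hK b).mp hb⟩
  let f := MulSemiringAction.toAlgAut G K L
  have := isGaloisGroup_range_toAlgAut K L G
  have : Finite f.range := Set.finite_range f
  have : IsGalois K L := IsGaloisGroup.isGalois f.range K L
  have : FiniteDimensional K L := IsGaloisGroup.finiteDimensional f.range K L
  have hmap (σ : G) := semilinear_apply_kaehlerDifferential_map (k := k) (K := K) (σ • ·)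
    (fun x ↦ (hK _).mpr ⟨x, rfl⟩ σ) (Φ σ) (hΦsmul σ) (hΦd σ)
  have lift (g : Gal(L/K)) : ∃ σ : G, ∀ x : L, σ • x = g x := by
    obtain ⟨⟨_, σ, rfl⟩, rfl⟩ := (IsGaloisGroup.mulEquivAlgEquiv f.range K L).surjective g
    exact ⟨σ, fun x ↦ rfl⟩
  choose s hs using lift
  have sum_mem (ω : KaehlerDifferential k L) :
      ∑ g : Gal(L/K), Φ (s g) ω ∈ Set.range (KaehlerDifferential.map k k K L) := by
    obtain ⟨t, rfl⟩ := mapBaseChange_surjective_of_isSeparable k K L ω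
    induction t using TensorProduct.induction_on with
    | zero => exact ⟨0, by simp⟩
    | add x y hx hy =>
      obtain ⟨u, hu⟩ := hx
      obtain ⟨v, hv⟩ := hy
      exact ⟨u + v, by simp only [map_add, hu, hv, Finset.sum_add_distrib]⟩
    | tmul a η =>
      refine ⟨Algebra.trace K L a • η, ?_⟩
      simp only [KaehlerDifferential.mapBaseChange_tmul, hΦsmul, hmap, hs, ← Finset.sum_smul]
      rw [← trace_eq_sum_automorphisms, map_smul, algebraMap_smul]
  ext ω
  refine ⟨fun (hω : ∀ σ : G, Φ σ ω = ω) ↦ ?_, ?_⟩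
  · obtain ⟨c, hc⟩ := Algebra.trace_surjective K L 1
    have h := sum_mem (c • ω)
    have hsum : ∑ g : Gal(L/K), Φ (s g) (c • ω) = ω := by
      simp only [hΦsmul, hs, hω, ← Finset.sum_smul]
      rw [← trace_eq_sum_automorphisms, hc, map_one, one_smul]
    rwa [hsum] at h
  · rintro ⟨η, rfl⟩ σ
    exact hmap σ η
end

section
/- Let k ⊆ K be an extension of fields of characteristic p > 0, let R be a commutative k-algebra, and let e ≥ 1 be an integer. If the e-th Frobenius K ⊗_k R → F^e_*(K ⊗_k R) splits as a homomorphism of (K ⊗_k R)-modules, then the e-th Frobenius R → F^e_*R splits as a homomorphism of R-modules. In particular, if K ⊗_k R is F-split then R is F-split. -/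
open scoped TensorProduct in
/-- Contracting the left factor of `K ⊗[k] R` along a `k`-linear form on `K` is `R`-linear. -/
theorem lid_rTensor_one_tmul_mul {k K R : Type*} [CommRing k] [CommRing K] [Algebra k K]
    [CommRing R] [Algebra k R] (π : K →ₗ[k] k) (a : R) (x : K ⊗[k] R) :
    TensorProduct.lid k R (π.rTensor R ((1 ⊗ₜ[k] a) * x)) =
      a * TensorProduct.lid k R (π.rTensor R x) := by
  induction x with
  | zero => simp
  | tmul b r => simp
  | add x y hx hy => simp only [mul_add, map_add, hx, hy]

/-- Let `k ⊆ K` be an extension of fields of characteristic `p > 0`, `R` a commutative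
`k`-algebra and `e ≥ 1`.  If the `e`-th Frobenius `K ⊗_k R → F^e_*(K ⊗_k R)` splits as a
`(K ⊗_k R)`-module homomorphism, then the `e`-th Frobenius `R → F^e_*R` splits as an
`R`-module homomorphism.  (An `R`-linear map `F^e_*R → R` is encoded as an additive map
`φ : R →+ R` satisfying `φ (a ^ (p ^ e) * x) = a * φ x`, and it splits the `e`-th
Frobenius iff `φ (a ^ (p ^ e)) = a` for all `a`.) -/
theorem stmt_10 (p : ℕ) (hp : p.Prime) (k K R : Type*) [Field k] [Field K] [Algebra k K]
    [CommRing R] [Algebra k R] [CharP k p] (e : ℕ) (he : 1 ≤ e)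
    (hsplit : ∃ ψ : TensorProduct k K R →+ TensorProduct k K R,
      (∀ a x : TensorProduct k K R, ψ (a ^ p ^ e * x) = a * ψ x) ∧
      (∀ a : TensorProduct k K R, ψ (a ^ p ^ e) = a)) :
    ∃ φ : R →+ R, (∀ a x : R, φ (a ^ p ^ e * x) = a * φ x) ∧
      (∀ a : R, φ (a ^ p ^ e) = a) := by
  obtain ⟨ψ, hmul, hpow⟩ := hsplit
  obtain ⟨π, hπ⟩ := (Algebra.linearMap k K).exists_leftInverse_of_injective
    (LinearMap.ker_eq_bot.mpr (algebraMap k K).injective)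
  have hπ_one : π 1 = 1 := by simpa using LinearMap.congr_fun hπ 1
  let c : TensorProduct k K R →+ R :=
    ((TensorProduct.lid k R).toLinearMap ∘ₗ π.rTensor R).toAddMonoidHom
  let i : R →+ TensorProduct k K R :=
    (Algebra.TensorProduct.includeRight : R →ₐ[k] TensorProduct k K R).toLinearMap.toAddMonoidHom
  refine ⟨c.comp (ψ.comp i), fun a x => ?_, fun a => ?_⟩
  · change c (ψ (Algebra.TensorProduct.includeRight (a ^ p ^ e * x))) = _
    rw [map_mul, map_pow, hmul]
    exact lid_rTensor_one_tmul_mul π a _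
  · change c (ψ (Algebra.TensorProduct.includeRight (a ^ p ^ e))) = _
    rw [map_pow, hpow]
    simp [c, hπ_one]
end
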